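/- arXiv:1711.09787 — 2 statements merged into one kernel-verified Lean document; each statement's English description precedes it below -/
import Mathlib

section
/- For any tree T on n ≥ 2 vertices and any real q with |q| > 1, the q-Laplacian L_T^q = I + q^2(D - I) - qA has exactly one negative eigenvalue (counted with multiplicity). -/
open Matrix SimpleGraph

/- The `q`-Laplacian of a graph: `I + q^2 (D - I) - q A`, where `D` is the diagonal
degree matrix and `A` the adjacency matrix. -/
open Classical in
noncomputable def qLap {V : Type*} [Fintype V] [DecidableEq V]
    (G : SimpleGraph V) (q : ℝ) : Matrix V V ℝ :=
  1 + q ^ 2 • (Matrix.diagonal (fun i => ((G.neighborSet i).ncard : ℝ)) - 1)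
    - q • Matrix.of (fun i j => if G.Adj i j then (1 : ℝ) else 0)

namespace Matrix.IsHermitian

variable {V : Type*} [Fintype V] [DecidableEq V] {A : Matrix V V ℝ}

lemma eigenvectorBasis_dotProduct (hA : A.IsHermitian) (i j : V) :
    ⇑(hA.eigenvectorBasis i) ⬝ᵥ ⇑(hA.eigenvectorBasis j) = if i = j then 1 else 0 := by
  rw [← orthonormal_iff_ite.mp hA.eigenvectorBasis.orthonormal i j,
    EuclideanSpace.inner_eq_star_dotProduct, star_trivial, dotProduct_comm]

/-- A real symmetric matrix whose quadratic form is nonnegative on a coordinate hyperplane and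
negative somewhere has exactly one negative eigenvalue. -/
lemma card_neg_roots_charpoly_eq_one (hA : A.IsHermitian) (r : V)
    (hnonneg : ∀ x : V → ℝ, x r = 0 → 0 ≤ x ⬝ᵥ (A *ᵥ x))
    (hneg : ∃ x : V → ℝ, x ⬝ᵥ (A *ᵥ x) < 0) :
    Multiset.card (A.charpoly.roots.filter (fun x => x < 0)) = 1 := by
  have hcard : Multiset.card (A.charpoly.roots.filter (fun x => x < 0)) =
      (Finset.univ.filter fun i => hA.eigenvalues i < 0).card := by
    rw [hA.roots_charpoly_eq_eigenvalues, Multiset.filter_map, Multiset.card_map]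
    rfl
  rw [hcard]
  refine le_antisymm (Finset.card_le_one.mpr fun i hi j hj => ?_) (Finset.card_pos.mpr ?_)
  · rw [Finset.mem_filter] at hi hj
    by_contra hij
    set e : V → V → ℝ := fun k => ⇑(hA.eigenvectorBasis k) with he
    have hform (a b : ℝ) : (a • e i + b • e j) ⬝ᵥ (A *ᵥ (a • e i + b • e j)) =
        a ^ 2 * hA.eigenvalues i + b ^ 2 * hA.eigenvalues j := by
      simp only [he, mulVec_add, mulVec_smul, hA.mulVec_eigenvectorBasis, dotProduct_add,
        add_dotProduct, smul_dotProduct, dotProduct_smul, hA.eigenvectorBasis_dotProduct,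
        hij, Ne.symm hij, if_true, if_false, smul_eq_mul]
      ring
    by_cases hr : e i r = 0
    · have h := hnonneg ((1 : ℝ) • e i + (0 : ℝ) • e j) (by simp [hr])
      rw [hform] at h
      linarith [hi.2]
    · have h := hnonneg (e j r • e i + (-e i r) • e j) (by simp; ring)
      rw [hform] at h
      nlinarith [mul_nonpos_of_nonneg_of_nonpos (sq_nonneg (e j r)) hi.2.le,
        mul_neg_of_pos_of_neg (pow_pos (abs_pos.mpr hr) 2) hj.2, sq_abs (e i r)]
  · by_contra hempty
    rw [Finset.not_nonempty_iff_eq_empty, Finset.filter_eq_empty_iff] at hempty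
    obtain ⟨x, hx⟩ := hneg
    have hpos : A.PosSemidef := hA.posSemidef_iff_eigenvalues_nonneg.mpr
      fun i => not_lt.mp (hempty (Finset.mem_univ i))
    exact hx.not_ge (by simpa using hpos.dotProduct_mulVec_nonneg x)

end Matrix.IsHermitian

namespace SimpleGraph

variable {V : Type*} {G : SimpleGraph V}

/-- In a tree rooted at `r`, every vertex other than `r` has a unique parent. -/
lemma IsTree.existsUnique_adj_dist (hG : G.IsTree) {r v : V} (hv : v ≠ r) :
    ∃! u, G.Adj u v ∧ G.dist r v = G.dist r u + 1 := by
  obtain ⟨p, -, hp⟩ := hG.connected.exists_path_of_dist v r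
  cases p with
  | nil => exact absurd rfl hv
  | @cons _ u _ h p =>
    rw [Walk.length_cons, dist_comm] at hp
    refine ⟨u, ⟨h.symm, ?_⟩, ?_⟩
    · have hle := dist_le p
      rw [dist_comm] at hle
      rcases hG.dist_eq_dist_add_one_of_adj r h with h' | h' <;> lia
    · rintro w ⟨hw, hdw⟩
      obtain ⟨s, -, hs⟩ := hG.connected.exists_path_of_dist w r
      have hs' : (Walk.cons hw.symm s).IsPath :=
        Walk.isPath_of_length_eq_dist _ (by
          rw [Walk.length_cons, hs, dist_comm, ← hdw, dist_comm])
      have hp' : (Walk.cons h p).IsPath :=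
        Walk.isPath_of_length_eq_dist _ (by rw [Walk.length_cons, hp, dist_comm])
      have heq := (hG.existsUnique_path v r).unique hs' hp'
      simpa using congrArg Walk.snd heq

end SimpleGraph

section QLaplacian

variable {V : Type*} [Fintype V] [DecidableEq V]

open Classical in
lemma qLap_isHermitian (G : SimpleGraph V) (q : ℝ) : (qLap G q).IsHermitian := by
  ext i j
  by_cases h : i = j
  · subst h
    rfl
  · suffices (if G.Adj j i then q else 0) = if G.Adj i j then q else 0 by
      simpa [qLap, h, Ne.symm h]
    exact if_congr (G.adj_comm j i) rfl rfl

open Classical in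
lemma qLap_dotProduct (G : SimpleGraph V) (q : ℝ) (x : V → ℝ) :
    x ⬝ᵥ (qLap G q *ᵥ x) =
      ∑ v, (x v ^ 2 + q ^ 2 * ((∑ u, if G.Adj u v then (1 : ℝ) else 0) - 1) * x v ^ 2)
      - q * ∑ v, ∑ u, (if G.Adj u v then (1 : ℝ) else 0) * (x u * x v) := by
  have hdeg (v : V) : ((G.neighborSet v).ncard : ℝ) = ∑ u, if G.Adj u v then (1 : ℝ) else 0 := by
    rw [Set.ncard_eq_toFinset_card', Finset.sum_boole]
    congr 2
    ext u
    simp [G.adj_comm]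
  simp only [qLap, sub_mulVec, add_mulVec, smul_mulVec, one_mulVec, dotProduct_sub, dotProduct_add,
    dotProduct_smul, smul_eq_mul]
  simp only [dotProduct, mulVec_diagonal, hdeg]
  simp only [mulVec, dotProduct, of_apply]
  rw [← Finset.sum_sub_distrib, Finset.mul_sum, ← Finset.sum_add_distrib]
  congr 1
  · refine Finset.sum_congr rfl fun v _ => ?_
    ring
  · congr 1
    refine Finset.sum_congr rfl fun v _ => ?_
    rw [Finset.mul_sum]
    refine Finset.sum_congr rfl fun u _ => ?_
    rw [G.adj_comm]
    ring

open Classical in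
/-- The quadratic form of the `q`-Laplacian of a tree rooted at `r`, as a sum over the pairs of a
vertex `v` and its parent `u`. -/
lemma SimpleGraph.IsTree.qLap_dotProduct_eq {G : SimpleGraph V} (hG : G.IsTree) (q : ℝ) (r : V)
    (x : V → ℝ) :
    x ⬝ᵥ (qLap G q *ᵥ x) =
      ∑ v, ∑ u, (if G.Adj u v ∧ G.dist r v = G.dist r u + 1 then (x v - q * x u) ^ 2 else 0)
      + (1 - q ^ 2) * x r ^ 2 := by
  set c : V → V → ℝ := fun u v => if G.Adj u v ∧ G.dist r v = G.dist r u + 1 then 1 else 0 with hc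
  have hadj (u v : V) : (if G.Adj u v then (1 : ℝ) else 0) = c u v + c v u := by
    simp only [hc, G.adj_comm v u]
    by_cases h : G.Adj u v
    · rcases hG.dist_eq_dist_add_one_of_adj r h with h' | h' <;> simp [h, h', add_assoc]
    · simp [h]
  have hparent (v : V) : ∑ u, c u v = 1 - if v = r then 1 else 0 := by
    by_cases hv : v = r
    · subst hv
      simp [hc]
    · obtain ⟨u, hu, huniq⟩ := hG.existsUnique_adj_dist hv
      rw [Finset.sum_eq_single u (fun w _ hw => if_neg fun h => hw (huniq w h)) (by simp)]
      simp [hu.1, hu.2, hv]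
  have hroot : x r ^ 2 = ∑ v, (if v = r then (1 : ℝ) else 0) * x v ^ 2 := by simp
  have hsum : ∑ v, ∑ u,
      (if G.Adj u v ∧ G.dist r v = G.dist r u + 1 then (x v - q * x u) ^ 2 else 0) =
      ∑ v, (∑ u, c u v) * x v ^ 2 + q ^ 2 * ∑ v, (∑ u, c v u) * x v ^ 2
        - q * (∑ v, ∑ u, c u v * (x u * x v) + ∑ v, ∑ u, c v u * (x u * x v)) := by
    have hswap : ∑ v, (∑ u, c v u) * x v ^ 2 = ∑ v, ∑ u, c u v * x u ^ 2 := by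
      rw [Finset.sum_comm]
      simp only [Finset.sum_mul]
    have hswap' : ∑ v, ∑ u, c v u * (x u * x v) = ∑ v, ∑ u, c u v * (x u * x v) := by
      rw [Finset.sum_comm]
      refine Finset.sum_congr rfl fun v _ => Finset.sum_congr rfl fun u _ => ?_
      rw [mul_comm (x v)]
    rw [hswap, hswap']
    simp only [Finset.mul_sum, Finset.sum_mul, ← Finset.sum_add_distrib, ← Finset.sum_sub_distrib]
    refine Finset.sum_congr rfl fun v _ => Finset.sum_congr rfl fun u _ => ?_
    simp only [hc]
    split_ifs <;> ring
  have hdiag : ∑ v, (x v ^ 2 + q ^ 2 * ((∑ u, (c u v + c v u)) - 1) * x v ^ 2) =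
      ∑ v, (∑ u, c u v) * x v ^ 2 + q ^ 2 * ∑ v, (∑ u, c v u) * x v ^ 2
        + (1 - q ^ 2) * x r ^ 2 := by
    rw [hroot, Finset.mul_sum, Finset.mul_sum, ← Finset.sum_add_distrib, ← Finset.sum_add_distrib]
    refine Finset.sum_congr rfl fun v _ => ?_
    rw [Finset.sum_add_distrib, hparent]
    ring
  rw [qLap_dotProduct, hsum]
  simp only [hadj]
  rw [hdiag]
  simp only [add_mul, Finset.sum_add_distrib]
  ring

end QLaplacian

/- For `|q| > 1`, the `q`-Laplacian of a tree on at least two vertices has exactly one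
negative eigenvalue, counted with algebraic multiplicity (i.e. as a root of the
characteristic polynomial). -/
theorem qLap_one_negative_eigenvalue {V : Type*} [Fintype V] [DecidableEq V]
    (G : SimpleGraph V) (hT : G.IsTree) (hn : 2 ≤ Fintype.card V)
    (q : ℝ) (hq : 1 < |q|) :
    Multiset.card (((qLap G q).charpoly.roots).filter (fun x => x < 0)) = 1 := by
  classical
  obtain ⟨r⟩ := hT.connected.nonempty
  have hq2 : 1 < q ^ 2 := (one_lt_sq_iff_one_lt_abs q).mpr hq
  refine (qLap_isHermitian G q).card_neg_roots_charpoly_eq_one r (fun x hx => ?_)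
    ⟨fun v => q ^ G.dist r v, ?_⟩
  · rw [hT.qLap_dotProduct_eq q r, hx]
    have : 0 ≤ ∑ v, ∑ u,
        (if G.Adj u v ∧ G.dist r v = G.dist r u + 1 then (x v - q * x u) ^ 2 else 0) :=
      Finset.sum_nonneg fun v _ => Finset.sum_nonneg fun u _ => by split_ifs <;> positivity
    linarith
  · rw [hT.qLap_dotProduct_eq q r, Finset.sum_eq_zero fun v _ => Finset.sum_eq_zero fun u _ => ?_]
    · simp
      linarith
    · split_ifs with h
      · rw [h.2]
        ring
      · rfl
end

section
/- Let T be a tree on n ≥ 2 vertices, l a leaf of T, and T' = T - {l}. Then for every real q with |q| > 1: λ_1(L_T^q) ≥ λ_1(L_{T'}^q) ≥ ... ≥ λ_{n-2}(L_{T'}^q) ≥ λ_{n-1}(L_T^q) > 0 > λ_n(L_T^q) ≥ λ_{n-1}(L_{T'}^q), where eigenvalues are in decreasing order. -/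
open Matrix SimpleGraph

theorem LinearMap.finrank_le_finrank_ker_add_one {K W : Type*} [Field K] [AddCommGroup W]
    [Module K W] [FiniteDimensional K W] (φ : W →ₗ[K] K) :
    Module.finrank K W ≤ Module.finrank K (LinearMap.ker φ) + 1 := by
  have h := φ.finrank_range_add_finrank_ker
  have h' := (LinearMap.range φ).finrank_le
  rw [Module.finrank_self] at h'
  lia

namespace Matrix

theorem real_dotProduct_self_nonneg {V : Type*} [Fintype V] (x : V → ℝ) : 0 ≤ x ⬝ᵥ x := by
  simpa using dotProduct_self_star_nonneg x

theorem real_dotProduct_self_pos {V : Type*} [Fintype V] {x : V → ℝ} (hx : x ≠ 0) :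
    0 < x ⬝ᵥ x := by
  simpa using dotProduct_self_star_pos_iff.2 hx

end Matrix

namespace Matrix.IsHermitian

variable {V : Type*} [Fintype V] [DecidableEq V] {A : Matrix V V ℝ} {N : ℕ} {μ : Fin N → ℝ}

/-- Orthogonal diagonalization of a real quadratic form, with the eigenvalues in decreasing
order. -/
theorem exists_diagonalization (hA : A.IsHermitian) (hμ : Antitone μ)
    (hroots : A.charpoly.roots = ↑(List.ofFn μ)) :
    ∃ e : (V → ℝ) ≃ₗ[ℝ] (Fin N → ℝ), (∀ x, x ⬝ᵥ A *ᵥ x = ∑ i, μ i * e x i ^ 2) ∧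
      ∀ x, x ⬝ᵥ x = ∑ i, e x i ^ 2 := by
  have hN : N = Fintype.card V := by
    have h := hA.roots_charpoly_eq_eigenvalues
    rw [hroots] at h
    simpa using congrArg Multiset.card h
  subst hN
  have hμ₀ : hA.eigenvalues₀ = μ := by
    have h := hA.sort_roots_charpoly_eq_eigenvalues₀
    rw [hroots, Multiset.map_congr rfl fun x _ => RCLike.re_to_real, Multiset.map_id',
      Multiset.coe_sort] at h
    rw [List.mergeSort_of_pairwise] at h
    · exact (List.ofFn_injective h).symm
    · simpa [List.pairwise_ofFn] using fun i j hij => hμ hij.le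
  subst hμ₀
  let σ : Fin (Fintype.card V) ≃ V := Fintype.equivOfCardEq (Fintype.card_fin _)
  have hσ (i) : hA.eigenvalues (σ i) = hA.eigenvalues₀ i := by
    simp [eigenvalues, σ]
  let b := hA.eigenvectorBasis.reindex σ.symm
  have hb (i) : A *ᵥ ⇑(b i) = hA.eigenvalues₀ i • ⇑(b i) := by
    rw [← hσ]
    simpa [b] using hA.mulVec_eigenvectorBasis (σ i)
  have hdot (x y : V → ℝ) :
      x ⬝ᵥ y = ∑ i, (⇑(b i) ⬝ᵥ x) * (⇑(b i) ⬝ᵥ y) := by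
    have h := b.sum_inner_mul_inner (WithLp.toLp 2 x) (WithLp.toLp 2 y)
    simp only [EuclideanSpace.inner_eq_star_dotProduct, star_trivial] at h
    rw [dotProduct_comm, ← h]
    exact Finset.sum_congr rfl fun i _ => by rw [dotProduct_comm y]
  refine ⟨(WithLp.linearEquiv 2 ℝ (V → ℝ)).symm ≪≫ₗ b.repr.toLinearEquiv ≪≫ₗ
    WithLp.linearEquiv 2 ℝ _, fun x => ?_, fun x => ?_⟩
  · rw [hdot]
    refine Finset.sum_congr rfl fun i _ => ?_
    have h : ⇑(b i) ⬝ᵥ A *ᵥ x = hA.eigenvalues₀ i * (⇑(b i) ⬝ᵥ x) := by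
      rw [dotProduct_mulVec, ← mulVec_transpose, ← conjTranspose_eq_transpose_of_trivial,
        hA.eq, hb, smul_dotProduct, smul_eq_mul]
    simp [h, b.repr_apply_apply, EuclideanSpace.inner_eq_star_dotProduct,
      dotProduct_comm x]
    ring
  · rw [hdot]
    refine Finset.sum_congr rfl fun i _ => ?_
    simp [b.repr_apply_apply, EuclideanSpace.inner_eq_star_dotProduct, dotProduct_comm x]
    ring

/-- Upper half of the Courant–Fischer principle. -/
theorem exists_ne_zero_form_le (hA : A.IsHermitian) (hμ : Antitone μ)
    (hroots : A.charpoly.roots = ↑(List.ofFn μ)) (k : Fin N)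
    {W : Type*} [AddCommGroup W] [Module ℝ W] [FiniteDimensional ℝ W]
    (hW : k < Module.finrank ℝ W) (f : W →ₗ[ℝ] V → ℝ) :
    ∃ w ≠ 0, f w ⬝ᵥ A *ᵥ f w ≤ μ k * (f w ⬝ᵥ f w) := by
  obtain ⟨e, he, he'⟩ := hA.exists_diagonalization hμ hroots
  let g : W →ₗ[ℝ] Fin k → ℝ :=
    LinearMap.funLeft ℝ ℝ (Fin.castLE k.2.le) ∘ₗ e.toLinearMap ∘ₗ f
  have hg : LinearMap.ker g ≠ ⊥ := g.ker_ne_bot_of_finrank_lt (by simpa using hW)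
  obtain ⟨w, hw, hw0⟩ := (Submodule.ne_bot_iff _).1 hg
  refine ⟨w, hw0, ?_⟩
  rw [he, he', Finset.mul_sum]
  refine Finset.sum_le_sum fun i _ => ?_
  rcases lt_or_ge i k with hik | hik
  · have : e (f w) i = 0 := congrFun (LinearMap.mem_ker.1 hw) ⟨i, hik⟩
    simp [this]
  · exact mul_le_mul_of_nonneg_right (hμ hik) (sq_nonneg _)

/-- Lower half of the Courant–Fischer principle. -/
theorem exists_submodule_le_form (hA : A.IsHermitian) (hμ : Antitone μ)
    (hroots : A.charpoly.roots = ↑(List.ofFn μ)) (k : Fin N) :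
    ∃ U : Submodule ℝ (V → ℝ), Module.finrank ℝ U = k + 1 ∧
      ∀ x ∈ U, μ k * (x ⬝ᵥ x) ≤ x ⬝ᵥ A *ᵥ x := by
  obtain ⟨e, he, he'⟩ := hA.exists_diagonalization hμ hroots
  let g : (Fin (k + 1) → ℝ) →ₗ[ℝ] V → ℝ :=
    e.symm.toLinearMap ∘ₗ Function.ExtendByZero.linearMap ℝ (Fin.castLE (n := k + 1) k.2)
  have hinj : Function.Injective (Fin.castLE (n := k + 1) k.2) := Fin.castLE_injective _
  have hg : Function.Injective g := by
    refine e.symm.injective.comp fun x y hxy => funext fun i => ?_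
    simpa [hinj.extend_apply] using congrFun hxy (Fin.castLE k.2 i)
  refine ⟨LinearMap.range g, by rw [LinearMap.finrank_range_of_inj hg]; simp, ?_⟩
  rintro _ ⟨y, rfl⟩
  rw [he, he', Finset.mul_sum]
  refine Finset.sum_le_sum fun i _ => ?_
  rcases le_or_gt i k with hik | hik
  · exact mul_le_mul_of_nonneg_right (hμ hik) (sq_nonneg _)
  · have : e (g y) i = 0 := by
      simp only [g, LinearMap.comp_apply, LinearEquiv.coe_coe, LinearEquiv.apply_symm_apply,
        Function.ExtendByZero.linearMap_apply]
      rw [Function.extend_apply' _ _ _ ?_, Pi.zero_apply]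
      rintro ⟨j, rfl⟩
      have := j.2
      simp [Fin.lt_def] at hik
      omega
    simp [this]

/-- The smallest eigenvalue bounds the Rayleigh quotient from below. -/
theorem le_form_of_last {N : ℕ} {μ : Fin (N + 1) → ℝ} (hA : A.IsHermitian) (hμ : Antitone μ)
    (hroots : A.charpoly.roots = ↑(List.ofFn μ)) (x : V → ℝ) :
    μ (Fin.last N) * (x ⬝ᵥ x) ≤ x ⬝ᵥ A *ᵥ x := by
  obtain ⟨e, he, he'⟩ := hA.exists_diagonalization hμ hroots
  rw [he, he', Finset.mul_sum]
  exact Finset.sum_le_sum fun i _ =>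
    mul_le_mul_of_nonneg_right (hμ (Fin.le_last i)) (sq_nonneg _)

end Matrix.IsHermitian

namespace SimpleGraph

section

variable {V : Type*} {G : SimpleGraph V}

theorem exists_forall_adj_iff_eq_of_ncard_neighborSet {l : V}
    (hl : (G.neighborSet l).ncard = 1) : ∃ p, ∀ v, G.Adj l v ↔ v = p := by
  obtain ⟨p, hp⟩ := Set.ncard_eq_one.1 hl
  exact ⟨p, fun v => by rw [← mem_neighborSet, hp, Set.mem_singleton_iff]⟩

theorem IsTree.induce_ne_of_forall_adj_iff_eq [Finite V] (hG : G.IsTree) {l p : V}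
    (hlp : ∀ v, G.Adj l v ↔ v = p) : (G.induce {v | v ≠ l}).IsTree := by
  classical
  have := Fintype.ofFinite V
  refine ⟨?_, hG.isAcyclic.induce _⟩
  exact hG.connected.induce_compl_singleton_of_degree_eq_one
    (degree_eq_one_iff_existsUnique_adj.2 ⟨p, (hlp p).2 rfl, fun v hv => (hlp v).1 hv⟩)

end

variable {V : Type*} [Fintype V] [DecidableEq V] (G : SimpleGraph V) (q : ℝ)

theorem isHermitian_qLap : (qLap G q).IsHermitian := by
  ext i j
  rcases eq_or_ne i j with rfl | h
  · simp [qLap]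
  · have hadj : G.Adj j i ↔ G.Adj i j := G.adj_comm j i
    by_cases hij : G.Adj i j
    · simp [qLap, hij, hadj.2 hij, h, h.symm]
    · simp [qLap, hij, mt hadj.1 hij, h, h.symm]

open Classical in
theorem qLap_form_eq_sum (x : V → ℝ) :
    x ⬝ᵥ qLap G q *ᵥ x = (1 - q ^ 2) * (x ⬝ᵥ x) +
      ∑ i, ∑ j, if G.Adj i j then q ^ 2 * x i ^ 2 - q * x i * x j else 0 := by
  have hdeg (i : V) : ((G.neighborSet i).ncard : ℝ) = ∑ j, if G.Adj i j then 1 else 0 := by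
    rw [Finset.sum_boole, Set.ncard_eq_toFinset_card']
    congr 2
    ext j
    simp
  simp only [dotProduct, mulVec, Finset.mul_sum]
  rw [← Finset.sum_add_distrib]
  refine Finset.sum_congr rfl fun i _ => ?_
  have h (j : V) : x i * (qLap G q i j * x j) =
      (if j = i then (1 - q ^ 2 + q ^ 2 * (G.neighborSet i).ncard) * (x i * x j) else 0) +
        if G.Adj i j then -q * x i * x j else 0 := by
    rcases eq_or_ne j i with rfl | hji
    · simp [qLap]
      ring
    · by_cases hij : G.Adj i j
      · simp [qLap, hij, hji, hji.symm]
        ring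
      · simp [qLap, hij, hji, hji.symm]
  simp only [h]
  rw [Finset.sum_add_distrib, Finset.sum_ite_eq' Finset.univ i, if_pos (Finset.mem_univ i), hdeg,
    add_mul, Finset.mul_sum, Finset.sum_mul, add_assoc, ← Finset.sum_add_distrib]
  congr 1
  refine Finset.sum_congr rfl fun j _ => ?_
  split_ifs <;> ring

variable {G}

/-- Completing the square at a leaf `l` with neighbour `p`. -/
theorem qLap_form_eq_add_sq {l p : V} (hlp : ∀ v, G.Adj l v ↔ v = p) (x : V → ℝ) :
    x ⬝ᵥ qLap G q *ᵥ x =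
      (fun v : {v | v ≠ l} => x v) ⬝ᵥ qLap (G.induce {v | v ≠ l}) q *ᵥ
        (fun v : {v | v ≠ l} => x v) + (q * x p - x l) ^ 2 := by
  classical
  have hpl (v) : G.Adj v l ↔ v = p := by rw [G.adj_comm, hlp]
  have hsplit (f : V → ℝ) : ∑ i, f i = f l + ∑ i : {v | v ≠ l}, f i :=
    Fintype.sum_eq_add_sum_subtype_ne f l
  rw [qLap_form_eq_sum, qLap_form_eq_sum, dotProduct, dotProduct, hsplit, hsplit]
  have h (i : {v | v ≠ l}) :
      (∑ j, if G.Adj i j then q ^ 2 * x i ^ 2 - q * x i * x j else 0) =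
        (if (i : V) = p then q ^ 2 * x i ^ 2 - q * x i * x l else 0) +
        ∑ j : {v | v ≠ l}, if (G.induce {v | v ≠ l}).Adj i j then
          q ^ 2 * x i ^ 2 - q * x i * x j else 0 := by
    rw [hsplit]
    simp only [hpl, comap_adj, Function.Embedding.subtype_apply]
  have hp : p ≠ l := ((hlp p).2 rfl).ne'
  have hsum : (∑ i : {v | v ≠ l}, if (i : V) = p then q ^ 2 * x i ^ 2 - q * x i * x l else 0) =
      q ^ 2 * x p ^ 2 - q * x p * x l := by
    have := hsplit fun i => if i = p then q ^ 2 * x i ^ 2 - q * x i * x l else 0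
    rw [if_neg hp.symm, zero_add] at this
    rw [← this, Finset.sum_ite_eq' Finset.univ p, if_pos (Finset.mem_univ p)]
  simp only [h, hlp]
  rw [Finset.sum_add_distrib, hsum, Finset.sum_ite_eq' Finset.univ p, if_pos (Finset.mem_univ p)]
  ring_nf

/-- For `1 < |q|`, the `q`-Laplacian of a tree has exactly one negative eigenvalue and is
nonsingular: its quadratic form takes a negative value, and is positive definite on a coordinate
hyperplane. -/
theorem IsTree.qLap_signature {q : ℝ} (hq : 1 < |q|) {V : Type*} [Fintype V] [DecidableEq V]
    {G : SimpleGraph V} (hG : G.IsTree) :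
    (∃ x : V → ℝ, x ⬝ᵥ qLap G q *ᵥ x < 0) ∧
      ∃ r : V, ∀ x : V → ℝ, x r = 0 → x ≠ 0 → 0 < x ⬝ᵥ qLap G q *ᵥ x := by
  classical
  induction hn : Fintype.card V using Nat.strong_induction_on generalizing V with
  | _ n ih =>
    have := hG.connected.nonempty
    rcases subsingleton_or_nontrivial V with hV | hV
    · obtain ⟨r⟩ := this
      have hq2 : 1 < q ^ 2 := (one_lt_sq_iff_one_lt_abs q).2 hq
      refine ⟨⟨fun _ => 1, ?_⟩, r, fun x hx hx0 => (hx0 ?_).elim⟩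
      · have : Unique V := ⟨⟨r⟩, fun v => Subsingleton.elim v r⟩
        have hadj (u v : V) : ¬ G.Adj u v := fun h => h.ne (Subsingleton.elim u v)
        rw [qLap_form_eq_sum]
        simpa [hadj, dotProduct] using hq2
      · ext v
        rw [Subsingleton.elim v r, hx, Pi.zero_apply]
    · obtain ⟨l, hl⟩ := hG.exists_vert_degree_one_of_nontrivial
      obtain ⟨p, hp, hlp⟩ := degree_eq_one_iff_existsUnique_adj.1 hl
      replace hlp (v) : G.Adj l v ↔ v = p := ⟨hlp v, fun h => h ▸ hp⟩
      obtain ⟨⟨x, hx⟩, r, hr⟩ := ih (Fintype.card {v | v ≠ l})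
        (hn ▸ Fintype.card_subtype_lt (x := l) (by simp))
        (hG.induce_ne_of_forall_adj_iff_eq hlp) rfl
      refine ⟨⟨fun v => if h : v = l then q * x ⟨p, hp.ne'⟩ else x ⟨v, h⟩, ?_⟩,
        r, fun y hyr hy => ?_⟩
      · rw [qLap_form_eq_add_sq q hlp]
        have h : (fun v : {v | v ≠ l} =>
            if h : (v : V) = l then q * x ⟨p, hp.ne'⟩ else x ⟨v, h⟩) = x :=
          funext fun v => dif_neg v.2
        rw [h]
        simpa [hp.ne'] using hx
      · rw [qLap_form_eq_add_sq q hlp]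
        by_cases hy' : (fun v : {v | v ≠ l} => y v) = 0
        · have hv (v) (h : v ≠ l) : y v = 0 := congrFun hy' ⟨v, h⟩
          have hyl : y l ≠ 0 := fun h => hy <| funext fun v => by
            by_cases hvl : v = l
            · rw [hvl, h, Pi.zero_apply]
            · exact hv v hvl
          rw [hy', hv p hp.ne']
          simp
          positivity
        · exact add_pos_of_pos_of_nonneg (hr _ hyr hy') (sq_nonneg _)

end SimpleGraph

/- Partial interlacing after deleting a leaf, for `|q| > 1`:
`λ₁(T) ≥ λ₁(T') ≥ λ₂(T) ≥ ⋯ ≥ λ_{n-2}(T') ≥ λ_{n-1}(T) > 0 > λ_n(T) ≥ λ_{n-1}(T')`,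
with `n = m+2`, where `μ`, `μ'` are the antitone enumerations of the eigenvalues. -/
theorem qLap_leaf_interlacing_of_one_lt_abs {m : ℕ}
    (G : SimpleGraph (Fin (m + 2))) (hT : G.IsTree)
    (l : Fin (m + 2)) (hl : (G.neighborSet l).ncard = 1)
    (q : ℝ) (hq : 1 < |q|)
    (μ : Fin (m + 2) → ℝ) (hμ : Antitone μ)
    (hroots : (qLap G q).charpoly.roots = ↑(List.ofFn μ))
    (μ' : Fin (m + 1) → ℝ) (hμ' : Antitone μ')
    (hroots' : (qLap (G.induce {v | v ≠ l}) q).charpoly.roots = ↑(List.ofFn μ')) :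
    (∀ i : Fin (m + 1), μ i.castSucc ≥ μ' i) ∧
      (∀ i : Fin m, μ' i.castSucc ≥ μ i.succ.castSucc) ∧
      0 < μ (⟨m, by omega⟩ : Fin (m + 2)) ∧
      μ (Fin.last (m + 1)) < 0 ∧
      μ (Fin.last (m + 1)) ≥ μ' (Fin.last m) := by
  obtain ⟨p, hlp⟩ := exists_forall_adj_iff_eq_of_ncard_neighborSet hl
  have hpl : p ≠ l := ((hlp p).2 rfl).ne'
  have hA := G.isHermitian_qLap q
  have hA' := (G.induce {v | v ≠ l}).isHermitian_qLap q
  have hform := qLap_form_eq_add_sq (G := G) q hlp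
  have hnorm (x : Fin (m + 2) → ℝ) : x ⬝ᵥ x =
      (fun v : {v | v ≠ l} => x v) ⬝ᵥ (fun v : {v | v ≠ l} => x v) + x l ^ 2 := by
    rw [dotProduct, Fintype.sum_eq_add_sum_subtype_ne _ l, add_comm, sq]
    rfl
  obtain ⟨⟨x₀, hx₀⟩, r, hr⟩ := hT.qLap_signature hq
  obtain ⟨⟨y₀, hy₀⟩, -⟩ := (hT.induce_ne_of_forall_adj_iff_eq hlp).qLap_signature hq
  have hlast : μ (Fin.last (m + 1)) < 0 := by
    by_contra! h
    exact hx₀.not_ge <| (mul_nonneg h (real_dotProduct_self_nonneg x₀)).trans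
      (hA.le_form_of_last hμ hroots x₀)
  have hlast' : μ' (Fin.last m) < 0 := by
    by_contra! h
    exact hy₀.not_ge <| (mul_nonneg h (real_dotProduct_self_nonneg y₀)).trans
      (hA'.le_form_of_last hμ' hroots' y₀)
  have hpos : 0 < μ (⟨m, by omega⟩ : Fin (m + 2)) := by
    let φ : (Fin (m + 2) → ℝ) →ₗ[ℝ] ℝ := LinearMap.proj r
    obtain ⟨w, hw, hle⟩ := hA.exists_ne_zero_form_le hμ hroots ⟨m, by omega⟩
      (W := LinearMap.ker φ)
      (by have := φ.finrank_le_finrank_ker_add_one; simp at this ⊢; omega)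
      (LinearMap.ker φ).subtype
    have hwr := hr w (LinearMap.mem_ker.1 w.2) (by simpa using hw)
    exact pos_of_mul_pos_left (hwr.trans_le hle) (real_dotProduct_self_nonneg _)
  refine ⟨fun i => ?_, fun i => ?_, hpos, hlast, ?_⟩
  · obtain ⟨U, hU, hge⟩ := hA'.exists_submodule_le_form hμ' hroots' i
    let f : ({v | v ≠ l} → ℝ) →ₗ[ℝ] Fin (m + 2) → ℝ :=
      Function.ExtendByZero.linearMap ℝ Subtype.val
    have hfl (x) : f x l = 0 := Function.extend_apply' _ _ _ (by simp)
    have hfx (x) : (fun v : {v | v ≠ l} => f x v) = x :=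
      funext fun v => Subtype.val_injective.extend_apply _ _ _
    obtain ⟨w, hw, hle⟩ := hA.exists_ne_zero_form_le hμ hroots i.castSucc (W := U)
      (by simp [hU]) (f ∘ₗ U.subtype)
    have h := hge w w.2
    simp only [LinearMap.comp_apply, Submodule.subtype_apply, hform, hnorm, hfx, hfl] at hle
    have hw' : 0 < (w : {v | v ≠ l} → ℝ) ⬝ᵥ w := by
      exact real_dotProduct_self_pos (by simpa using hw)
    nlinarith [sq_nonneg (q * f w p)]
  · obtain ⟨U, hU, hge⟩ := hA.exists_submodule_le_form hμ hroots i.succ.castSucc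
    let φ : U →ₗ[ℝ] ℝ := (q • LinearMap.proj p - LinearMap.proj l) ∘ₗ U.subtype
    obtain ⟨w, hw, hle⟩ := hA'.exists_ne_zero_form_le hμ' hroots' i.castSucc
      (W := LinearMap.ker φ)
      (by have := φ.finrank_le_finrank_ker_add_one; simp [hU] at this ⊢; omega)
      (LinearMap.funLeft ℝ ℝ Subtype.val ∘ₗ U.subtype ∘ₗ (LinearMap.ker φ).subtype)
    set x : Fin (m + 2) → ℝ := w.1.1
    have hx : q * x p - x l = 0 := LinearMap.mem_ker.1 w.2
    have hge' := hge x w.1.2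
    have hx0 : (fun v : {v | v ≠ l} => x v) ≠ 0 := fun h => hw <| by
      have hv (v) (h' : v ≠ l) : x v = 0 := congrFun h ⟨v, h'⟩
      refine Subtype.ext (Subtype.ext (funext fun v => ?_))
      by_cases hvl : v = l
      · rw [hv p hpl] at hx
        rw [hvl]
        simpa using hx
      · exact hv v hvl
    replace hx0 : 0 < (fun v : {v | v ≠ l} => x v) ⬝ᵥ (fun v : {v | v ≠ l} => x v) :=
      real_dotProduct_self_pos hx0
    replace hle : (fun v : {v | v ≠ l} => x v) ⬝ᵥ qLap (G.induce {v | v ≠ l}) q *ᵥ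
        (fun v : {v | v ≠ l} => x v) ≤ μ' i.castSucc *
          ((fun v : {v | v ≠ l} => x v) ⬝ᵥ (fun v : {v | v ≠ l} => x v)) := hle
    rw [hform, hnorm, hx] at hge'
    have hμi : 0 < μ i.succ.castSucc := hpos.trans_le (hμ (by simp [Fin.le_def]))
    nlinarith [mul_nonneg hμi.le (sq_nonneg (x l))]
  · obtain ⟨x, hx, hle⟩ := hA.exists_ne_zero_form_le hμ hroots (Fin.last (m + 1))
      (W := Fin (m + 2) → ℝ) (by simp) LinearMap.id
    have h := hA'.le_form_of_last hμ' hroots' (fun v : {v | v ≠ l} => x v)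
    have hx' : 0 < x ⬝ᵥ x := real_dotProduct_self_pos hx
    rw [LinearMap.id_apply, hform] at hle
    have hx2 := hnorm x
    nlinarith [sq_nonneg (q * x p - x l), mul_nonneg (neg_nonneg.2 hlast'.le) (sq_nonneg (x l))]
end
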